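/- Under assumptions (A1) and (A3–A7), with constant step size γ = 1/(2R²√N) for a fixed horizon N ≥ 1 and for every t with 0 ≤ t ≤ N/2: (i) P(f(θ̄_N) − f(θ*) ≥ 15t/√N + 6R²‖θ_0 − θ*‖²/√N) ≤ 2·exp(−t); and (ii) P(‖θ_N − θ*‖² ≥ 15·R^{−2}·t + 6‖θ_0 − θ*‖²) ≤ 2·exp(−t), where θ̄_N = (1/N)·Σ_{k=0}^{N−1} θ_k. -/

import Mathlib

open MeasureTheory

theorem Real.exp_le_add_exp_sq (x : ℝ) : Real.exp x ≤ x + Real.exp (x ^ 2) := by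
  have h2 := Real.add_one_le_exp (x ^ 2)
  rcases le_or_gt |x| 1 with h | h
  · have := (abs_le.1 (Real.abs_exp_sub_one_sub_id_le h)).2
    linarith
  · rcases lt_abs.1 h with h | h
    · have : Real.exp x ≤ Real.exp (x ^ 2) := Real.exp_le_exp.2 (by nlinarith)
      linarith
    · have : Real.exp x ≤ 1 := Real.exp_le_one_iff.2 (by linarith)
      nlinarith

theorem ConvexOn.sub_le_inner_gradient {H : Type*} [NormedAddCommGroup H] [InnerProductSpace ℝ H]
    [CompleteSpace H] {f : H → ℝ} (hf : ConvexOn ℝ Set.univ f) {x : H}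
    (hd : DifferentiableAt ℝ f x) (y : H) :
    f x - f y ≤ inner ℝ (x - y) (gradient f x) := by
  have hline : ConvexOn ℝ Set.univ (f ∘ AffineMap.lineMap (k := ℝ) x y) := by
    simpa using hf.comp_affineMap (AffineMap.lineMap (k := ℝ) x y)
  have hderiv : HasDerivAt (f ∘ AffineMap.lineMap (k := ℝ) x y) (fderiv ℝ f x (y - x)) 0 := by
    refine HasFDerivAt.comp_hasDerivAt (0 : ℝ) ?_ AffineMap.hasDerivAt_lineMap
    simpa using hd.hasFDerivAt
  have h := hline.le_slope_of_hasDerivAt (Set.mem_univ 0) (Set.mem_univ 1) one_pos hderiv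
  rw [← inner_gradient_left, real_inner_comm] at h
  simp only [slope_def_field, Function.comp_apply, AffineMap.lineMap_apply_one,
    AffineMap.lineMap_apply_zero, sub_zero, div_one] at h
  rw [← neg_sub y x, inner_neg_left]
  linarith

/-- The difference between a random vector and its conditional expectation is orthogonal to
bounded vectors measurable with respect to the conditioning σ-algebra. -/
theorem MeasureTheory.integral_inner_sub_eq_zero {H Ω : Type*} [NormedAddCommGroup H]
    [InnerProductSpace ℝ H] [CompleteSpace H] {m mΩ : MeasurableSpace Ω} {P : Measure Ω}
    [IsFiniteMeasure P] (hm : m ≤ mΩ) {g h W : Ω → H} {C : ℝ} (hg : Integrable g P)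
    (hgh : P[g|m] =ᵐ[P] h) (hW : StronglyMeasurable[m] W) (hWC : ∀ᵐ ω ∂P, ‖W ω‖ ≤ C) :
    Integrable (fun ω => inner ℝ (W ω) (h ω - g ω)) P ∧
      ∫ ω, inner ℝ (W ω) (h ω - g ω) ∂P = 0 := by
  have hint : ∀ k : Ω → H, Integrable k P → Integrable (fun ω => inner ℝ (W ω) (k ω)) P := by
    intro k hk
    refine (hk.norm.const_mul C).mono'
      ((hW.mono hm).aestronglyMeasurable.inner hk.aestronglyMeasurable) ?_
    filter_upwards [hWC] with ω hω
    exact (norm_inner_le_norm _ _).trans (by gcongr)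
  have hh : Integrable h P := integrable_condExp.congr hgh
  refine ⟨hint _ (hh.sub hg), ?_⟩
  have hpull := condExp_bilin_of_stronglyMeasurable_left (innerSL ℝ (E := H)) hW
    (hint g hg) hg
  have h1 : ∫ ω, inner ℝ (W ω) (g ω) ∂P = ∫ ω, inner ℝ (W ω) (h ω) ∂P := by
    rw [← integral_condExp hm]
    refine integral_congr_ae ?_
    filter_upwards [hpull, hgh] with ω h1 h2
    rw [h2] at h1
    exact h1
  simp_rw [inner_sub_right]
  rw [integral_sub (hint h hh) (hint g hg), h1, sub_self]

/-- One step of an exponential supermartingale argument: the noise `ξ` is centred under the tilted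
measure, and its square is controlled by the current value `Y`. -/
theorem MeasureTheory.integral_exp_le_of_le_add_noise {Ω : Type*} {mΩ : MeasurableSpace Ω}
    {P : Measure Ω} {X Y ξ : Ω → ℝ} {b v l k : ℝ} (hl : 0 ≤ l) (hk : l + v * l ^ 2 ≤ k)
    (hX : ∀ᵐ ω ∂P, X ω ≤ Y ω + ξ ω + b) (hξ : ∀ᵐ ω ∂P, ξ ω ^ 2 ≤ v * Y ω)
    (hY : ∀ᵐ ω ∂P, 0 ≤ Y ω)
    (hiX : Integrable (fun ω => Real.exp (l * X ω)) P)
    (hiY : Integrable (fun ω => Real.exp (k * Y ω)) P)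
    (hiξ : Integrable (fun ω => ξ ω * Real.exp (l * Y ω)) P)
    (hξ0 : ∫ ω, ξ ω * Real.exp (l * Y ω) ∂P = 0) :
    ∫ ω, Real.exp (l * X ω) ∂P ≤ Real.exp (l * b) * ∫ ω, Real.exp (k * Y ω) ∂P := by
  calc ∫ ω, Real.exp (l * X ω) ∂P
      ≤ ∫ ω, Real.exp (l * b) * (l * (ξ ω * Real.exp (l * Y ω)) + Real.exp (k * Y ω)) ∂P := by
        refine integral_mono_ae hiX (((hiξ.const_mul l).add hiY).const_mul _) ?_
        filter_upwards [hX, hξ, hY] with ω h1 h2 h3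
        have e1 : Real.exp (l * X ω)
            ≤ Real.exp (l * b) * (Real.exp (l * Y ω) * Real.exp (l * ξ ω)) := by
          rw [← Real.exp_add, ← Real.exp_add]
          exact Real.exp_le_exp.2 (by nlinarith)
        have e2 : Real.exp (l * Y ω) * Real.exp ((l * ξ ω) ^ 2) ≤ Real.exp (k * Y ω) := by
          rw [← Real.exp_add]
          refine Real.exp_le_exp.2 ?_
          have := mul_le_mul_of_nonneg_left h2 (sq_nonneg l)
          have := mul_le_mul_of_nonneg_right hk h3
          nlinarith
        refine e1.trans (mul_le_mul_of_nonneg_left ?_ (Real.exp_pos _).le)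
        have := mul_le_mul_of_nonneg_left (Real.exp_le_add_exp_sq (l * ξ ω))
          (Real.exp_pos (l * Y ω)).le
        nlinarith
    _ = Real.exp (l * b) * ∫ ω, Real.exp (k * Y ω) ∂P := by
        rw [integral_const_mul, integral_add (hiξ.const_mul l) hiY, integral_const_mul, hξ0]
        simp

/-- Rescaled squared distance to the minimizer plus accumulated excess risk. -/
noncomputable def sgdPotential {H : Type*} [NormedAddCommGroup H]
    (f : H → ℝ) (x₀ : H) (R β : ℝ) (x : ℕ → H) (n : ℕ) : ℝ :=
  R ^ 2 * ‖x n - x₀‖ ^ 2 + 2 * β * ∑ k ∈ Finset.range n, (f (x k) - f x₀)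

section Potential

variable {H : Type*} [NormedAddCommGroup H] {f : H → ℝ} {x₀ : H} {R β : ℝ} {x : ℕ → H}

theorem sq_dist_le_sgdPotential (hβ : 0 ≤ β) (hmin : ∀ y, f x₀ ≤ f y) (n : ℕ) :
    R ^ 2 * ‖x n - x₀‖ ^ 2 ≤ sgdPotential f x₀ R β x n := by
  have := Finset.sum_nonneg fun k (_ : k ∈ Finset.range n) => sub_nonneg.2 (hmin (x k))
  unfold sgdPotential
  nlinarith [mul_nonneg hβ this]

theorem sgdPotential_nonneg (hβ : 0 ≤ β) (hmin : ∀ y, f x₀ ≤ f y) (n : ℕ) :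
    0 ≤ sgdPotential f x₀ R β x n :=
  (by positivity : 0 ≤ R ^ 2 * ‖x n - x₀‖ ^ 2).trans (sq_dist_le_sgdPotential hβ hmin n)

theorem sum_le_sgdPotential (n : ℕ) :
    2 * β * ∑ k ∈ Finset.range n, (f (x k) - f x₀) ≤ sgdPotential f x₀ R β x n :=
  le_add_of_nonneg_left (by positivity)

theorem sgdPotential_succ_le [InnerProductSpace ℝ H] [CompleteSpace H] {γ : ℝ} (hβ : 0 ≤ β)
    (hγ : β = γ * R ^ 2) (hf : ConvexOn ℝ Set.univ f) (hd : Differentiable ℝ f)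
    {n : ℕ} {g : H} (hg : ‖g‖ ≤ R) (hx : x (n + 1) = x n - γ • g) :
    sgdPotential f x₀ R β x (n + 1) ≤ sgdPotential f x₀ R β x n
      + 2 * β * inner ℝ (x n - x₀) (gradient f (x n) - g) + β ^ 2 := by
  have h1 := hf.sub_le_inner_gradient (hd (x n)) x₀
  have h2 : ‖x (n + 1) - x₀‖ ^ 2
      = ‖x n - x₀‖ ^ 2 - 2 * γ * inner ℝ (x n - x₀) g + γ ^ 2 * ‖g‖ ^ 2 := by
    rw [hx, sub_right_comm, norm_sub_sq_real, inner_smul_right, norm_smul, mul_pow,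
      Real.norm_eq_abs, sq_abs]
    ring
  have h3 : ‖g‖ ^ 2 ≤ R ^ 2 := by gcongr
  have h4 := mul_le_mul_of_nonneg_left h3 (by positivity : 0 ≤ R ^ 2 * γ ^ 2)
  have h5 := mul_le_mul_of_nonneg_left h1 hβ
  unfold sgdPotential
  rw [h2, Finset.sum_range_succ, inner_sub_right]
  subst hγ
  linarith

theorem sq_noise_le_sgdPotential [InnerProductSpace ℝ H] (hβ : 0 ≤ β)
    (hmin : ∀ y, f x₀ ≤ f y) {n : ℕ} {g h : H} (hg : ‖g‖ ≤ R) (hh : ‖h‖ ≤ R) :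
    (2 * β * inner ℝ (x n - x₀) (h - g)) ^ 2 ≤ 16 * β ^ 2 * sgdPotential f x₀ R β x n := by
  have h1 : |inner ℝ (x n - x₀) (h - g)| ≤ ‖x n - x₀‖ * (2 * R) :=
    (abs_real_inner_le_norm _ _).trans (by
      gcongr
      exact (norm_sub_le _ _).trans (by linarith))
  have h2 : (inner ℝ (x n - x₀) (h - g)) ^ 2 ≤ (‖x n - x₀‖ * (2 * R)) ^ 2 := by
    rw [← sq_abs]
    gcongr
  have h3 := mul_le_mul_of_nonneg_left (sq_dist_le_sgdPotential (x := x) (R := R) hβ hmin n)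
    (by positivity : 0 ≤ 16 * β ^ 2)
  have h4 := mul_le_mul_of_nonneg_left h2 (by positivity : 0 ≤ 4 * β ^ 2)
  linarith

end Potential

/-- Exponential moment bound for the potential of stochastic gradient descent. -/
theorem integral_exp_sgdPotential_le
    {H : Type*} [NormedAddCommGroup H] [InnerProductSpace ℝ H] [CompleteSpace H]
    {Ω : Type*} {mΩ : MeasurableSpace Ω} {P : Measure Ω} [IsProbabilityMeasure P]
    {ℱ : Filtration ℕ mΩ} {f : H → ℝ} {x₀ y₀ : H} {R γ β c : ℝ} {θ g : ℕ → Ω → H}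
    (hR : 0 < R) (hγ : 0 < γ) (hβ : β = γ * R ^ 2) (hc : 0 < c)
    (hf : ConvexOn ℝ Set.univ f) (hd : Differentiable ℝ f) (hmin : ∀ y, f x₀ ≤ f y)
    (hfR : ∀ y, ‖gradient f y‖ ≤ R) (hgR : ∀ n, ∀ᵐ ω ∂P, ‖g n ω‖ ≤ R)
    (hθ : ∀ n, StronglyMeasurable[ℱ n] (θ n))
    (hg : ∀ n, P[g n|ℱ n] =ᵐ[P] fun ω => gradient f (θ n ω))
    (hθ0 : ∀ ω, θ 0 ω = y₀) (hrec : ∀ n ω, θ (n + 1) ω = θ n ω - γ • g n ω) (n : ℕ) :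
    Integrable (fun ω => Real.exp ((c + 16 * β ^ 2 * n)⁻¹ *
        sgdPotential f x₀ R β (fun k => θ k ω) n)) P ∧
      ∫ ω, Real.exp ((c + 16 * β ^ 2 * n)⁻¹ * sgdPotential f x₀ R β (fun k => θ k ω) n) ∂P
        ≤ Real.exp (c⁻¹ * (R ^ 2 * ‖y₀ - x₀‖ ^ 2 + n * β ^ 2)) := by
  have hβ0 : 0 < β := by rw [hβ]; positivity
  set Y : ℕ → Ω → ℝ := fun n ω => sgdPotential f x₀ R β (fun k => θ k ω) n with hY
  set ξ : ℕ → Ω → ℝ := fun n ω =>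
    2 * β * inner ℝ (θ n ω - x₀) (gradient f (θ n ω) - g n ω) with hξ
  have hY0 (n : ℕ) (ω : Ω) : 0 ≤ Y n ω := sgdPotential_nonneg hβ0.le hmin n
  have hstep (n : ℕ) : ∀ᵐ ω ∂P, Y (n + 1) ω ≤ Y n ω + ξ n ω + β ^ 2 := by
    filter_upwards [hgR n] with ω hω
    exact sgdPotential_succ_le hβ0.le hβ hf hd hω (hrec n ω)
  have hξsq (n : ℕ) : ∀ᵐ ω ∂P, ξ n ω ^ 2 ≤ 16 * β ^ 2 * Y n ω := by
    filter_upwards [hgR n] with ω hω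
    exact sq_noise_le_sgdPotential (x := fun k => θ k ω) hβ0.le hmin hω (hfR _)
  have hYm (n : ℕ) : StronglyMeasurable[ℱ n] (Y n) := by
    have hdist : StronglyMeasurable[ℱ n] fun ω => R ^ 2 * ‖θ n ω - x₀‖ ^ 2 :=
      (((hθ n).sub stronglyMeasurable_const).norm.pow 2).const_mul _
    refine hdist.add (StronglyMeasurable.const_mul ?_ _)
    refine Finset.stronglyMeasurable_fun_sum _ fun k hk => ?_
    exact (hd.continuous.comp_stronglyMeasurable ((hθ k).mono
      (ℱ.mono (Finset.mem_range.1 hk).le))).sub stronglyMeasurable_const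
  have hYb (n : ℕ) : ∃ K, ∀ᵐ ω ∂P, Y n ω ≤ K := by
    induction n with
    | zero => exact ⟨R ^ 2 * ‖y₀ - x₀‖ ^ 2, by simp [hY, sgdPotential, hθ0]⟩
    | succ n ih =>
      obtain ⟨K, hK⟩ := ih
      refine ⟨K + (1 + 16 * β ^ 2 * K) + β ^ 2, ?_⟩
      filter_upwards [hK, hstep n, hξsq n] with ω h1 h2 h3
      have := mul_le_mul_of_nonneg_left h1 (by positivity : 0 ≤ 16 * β ^ 2)
      nlinarith [sq_nonneg (ξ n ω - 1)]
  have hexpm (l : ℝ) (n : ℕ) : StronglyMeasurable[ℱ n] fun ω => Real.exp (l * Y n ω) :=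
    Real.continuous_exp.comp_stronglyMeasurable ((hYm n).const_mul l)
  have hexpb (l : ℝ) (hl : 0 ≤ l) (n : ℕ) : ∃ K, ∀ᵐ ω ∂P, Real.exp (l * Y n ω) ≤ K := by
    obtain ⟨K, hK⟩ := hYb n
    refine ⟨Real.exp (l * K), ?_⟩
    filter_upwards [hK] with ω h
    gcongr
  have hexpi (l : ℝ) (hl : 0 ≤ l) (n : ℕ) : Integrable (fun ω => Real.exp (l * Y n ω)) P := by
    obtain ⟨K, hK⟩ := hexpb l hl n
    refine Integrable.of_bound ((hexpm l n).mono (ℱ.le n)).aestronglyMeasurable K ?_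
    filter_upwards [hK] with ω h
    rwa [Real.norm_eq_abs, Real.abs_exp]
  have hgi (n : ℕ) : Integrable (g n) P := by
    have : g n = fun ω => γ⁻¹ • (θ n ω - θ (n + 1) ω) := by
      funext ω
      rw [hrec, sub_sub_cancel, inv_smul_smul₀ hγ.ne']
    refine Integrable.of_bound ?_ R (hgR n)
    rw [this]
    exact (((hθ n).mono (ℱ.le n)).sub ((hθ (n + 1)).mono (ℱ.le _))).aestronglyMeasurable.const_smul
      γ⁻¹
  have hnoise (l : ℝ) (hl : 0 ≤ l) (n : ℕ) :
      Integrable (fun ω => ξ n ω * Real.exp (l * Y n ω)) P ∧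
        ∫ ω, ξ n ω * Real.exp (l * Y n ω) ∂P = 0 := by
    obtain ⟨K, hK⟩ := hYb n
    obtain ⟨L, hL⟩ := hexpb l hl n
    have hbound : ∀ᵐ ω ∂P, ‖(2 * β * Real.exp (l * Y n ω)) • (θ n ω - x₀)‖
        ≤ 2 * β * L * √(K / R ^ 2) := by
      filter_upwards [hK, hL] with ω h1 h2
      have h3 : ‖θ n ω - x₀‖ ≤ √(K / R ^ 2) := by
        refine Real.le_sqrt_of_sq_le ((le_div_iff₀ (by positivity)).2 ?_)
        have := sq_dist_le_sgdPotential (x := fun k => θ k ω) (R := R) hβ0.le hmin n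
        exact (mul_comm _ _).trans_le (this.trans h1)
      have hL0 : 0 ≤ L := (Real.exp_pos _).le.trans h2
      rw [norm_smul, Real.norm_of_nonneg (by positivity)]
      gcongr
    have hWm : StronglyMeasurable[ℱ n]
        fun ω => (2 * β * Real.exp (l * Y n ω)) • (θ n ω - x₀) :=
      ((hexpm l n).const_mul (2 * β)).smul ((hθ n).sub stronglyMeasurable_const)
    have h := integral_inner_sub_eq_zero (ℱ.le n) (hgi n) (hg n) hWm hbound
    have heq : (fun ω => inner ℝ ((2 * β * Real.exp (l * Y n ω)) • (θ n ω - x₀))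
        (gradient f (θ n ω) - g n ω)) = fun ω => ξ n ω * Real.exp (l * Y n ω) := by
      funext ω
      rw [real_inner_smul_left]
      ring
    rwa [heq] at h
  refine ⟨hexpi _ (by positivity) n, ?_⟩
  induction n with
  | zero => simp [sgdPotential, hθ0]
  | succ n ih =>
    set u : ℝ := c + 16 * β ^ 2 * n with hu
    have hcu : c ≤ u := le_add_of_nonneg_right (by positivity)
    have hu0 : 0 < u := hc.trans_le hcu
    have hsucc : c + 16 * β ^ 2 * ((n + 1 : ℕ) : ℝ) = u + 16 * β ^ 2 := by
      push_cast
      ring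
    rw [hsucc]
    have hk : (u + 16 * β ^ 2)⁻¹ + 16 * β ^ 2 * (u + 16 * β ^ 2)⁻¹ ^ 2 ≤ u⁻¹ := by
      have : 0 ≤ u⁻¹ * (16 * β ^ 2 * (u + 16 * β ^ 2)⁻¹) ^ 2 := by positivity
      refine le_of_sub_nonneg (this.trans_eq ?_)
      field_simp
      ring
    have hn := hnoise (u + 16 * β ^ 2)⁻¹ (by positivity) n
    refine (integral_exp_le_of_le_add_noise (by positivity) hk (hstep n) (hξsq n)
      (ae_of_all _ (hY0 n)) (hexpi _ (by positivity) _) (hexpi _ (by positivity) n)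
      hn.1 hn.2).trans ((mul_le_mul_of_nonneg_left ih (Real.exp_pos _).le).trans ?_)
    rw [← Real.exp_add]
    refine Real.exp_le_exp.2 ?_
    have : (u + 16 * β ^ 2)⁻¹ ≤ c⁻¹ := inv_anti₀ hc (by nlinarith [sq_nonneg β])
    have := mul_le_mul_of_nonneg_right this (sq_nonneg β)
    push_cast
    linarith

theorem bach_corollary_dev
    {H : Type*} [NormedAddCommGroup H] [InnerProductSpace ℝ H] [CompleteSpace H]
    {Ω : Type*} {mΩ : MeasurableSpace Ω} {P : Measure Ω} [IsProbabilityMeasure P]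
    (ℱ : Filtration ℕ mΩ)
    (f : H → ℝ) (F : ℕ → Ω → H → ℝ) (θstar θ0 : H) (R γ : ℝ)
    (θ : ℕ → Ω → H)
    (hR : 0 < R)
    (N : ℕ) (hN : 1 ≤ N)
    (hγ : γ = 1 / (2 * R ^ 2 * Real.sqrt N))
    -- (A1) convexity and differentiability of f
    (hf_conv : ConvexOn ℝ Set.univ f)
    (hf_diff : Differentiable ℝ f)
    -- (A3) attained global minimum
    (hmin : ∀ θ' : H, f θstar ≤ f θ')
    -- (A4) Lipschitz-continuity of f and the fₙ
    (hf_grad_bound : ∀ θ' : H, ‖gradient f θ'‖ ≤ R)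
    (hF_grad_bound : ∀ n : ℕ, ∀ᵐ ω ∂P, ∀ θ' : H, ‖gradient (F n ω) θ'‖ ≤ R)
    (hF_conv : ∀ n ω, ConvexOn ℝ Set.univ (F n ω))
    (hF_diff : ∀ n ω, Differentiable ℝ (F n ω))
    -- (A5) adapted measurability
    (hF_meas : ∀ n : ℕ, ∀ x : H, StronglyMeasurable[ℱ n] (fun ω => F n ω x))
    (hθ_adapted : ∀ n : ℕ, StronglyMeasurable[ℱ n] (θ n))
    -- (A6) unbiased gradients
    (hunbiased : ∀ n : ℕ, 1 ≤ n →
      P[(fun ω => gradient (F n ω) (θ (n - 1) ω))|ℱ (n - 1)]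
        =ᵐ[P] fun ω => gradient f (θ (n - 1) ω))
    -- (A7) stochastic gradient recursion
    (hθ0 : ∀ ω, θ 0 ω = θ0)
    (hrec : ∀ n : ℕ, 1 ≤ n → ∀ ω,
      θ n ω = θ (n - 1) ω - γ • gradient (F n ω) (θ (n - 1) ω))
    (t : ℝ) (ht0 : 0 ≤ t) (ht : t ≤ N / 2)
    :
    (P {ω | f (((N : ℝ))⁻¹ • ∑ k ∈ Finset.range N, θ k ω) - f θstar
          ≥ 15 * t / Real.sqrt N + 6 * R ^ 2 * ‖θ0 - θstar‖ ^ 2 / Real.sqrt N}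
        ≤ ENNReal.ofReal (2 * Real.exp (-t))) ∧
    (P {ω | ‖θ N ω - θstar‖ ^ 2 ≥ 15 * R⁻¹ ^ 2 * t + 6 * ‖θ0 - θstar‖ ^ 2}
        ≤ ENNReal.ofReal (2 * Real.exp (-t))) := by
  have hN0 : (0 : ℝ) < N := by exact_mod_cast hN
  have hs : 0 < √(N : ℝ) := Real.sqrt_pos.2 hN0
  have hs2 : √(N : ℝ) ^ 2 = N := Real.sq_sqrt hN0.le
  have hγ0 : 0 < γ := by rw [hγ]; positivity
  set β : ℝ := γ * R ^ 2 with hβ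
  have hβs : 2 * β * √(N : ℝ) = 1 := by
    rw [hβ, hγ]
    field_simp
  have hβN : 4 * (β ^ 2 * N) = 1 := by
    rw [← hs2]
    linear_combination (2 * β * √(N : ℝ) + 1) * hβs
  have hβ0 : 0 < β := by positivity
  set D : ℝ := R ^ 2 * ‖θ0 - θstar‖ ^ 2 with hD
  have hgR (n : ℕ) : ∀ᵐ ω ∂P, ‖gradient (F (n + 1) ω) (θ n ω)‖ ≤ R :=
    (hF_grad_bound (n + 1)).mono fun ω h => h _
  obtain ⟨hint, hle⟩ := integral_exp_sgdPotential_le (c := 4 / 5) hR hγ0 hβ (by norm_num) hf_conv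
    hf_diff hmin hf_grad_bound hgR hθ_adapted (fun n => hunbiased (n + 1) n.succ_pos) hθ0
    (fun n ω => hrec (n + 1) n.succ_pos ω) N
  have hrate : (4 / 5 + 16 * β ^ 2 * N : ℝ)⁻¹ = 5 / 24 := by
    rw [show (4 / 5 + 16 * β ^ 2 * N : ℝ) = 24 / 5 by linarith]
    norm_num
  rw [hrate] at hint hle
  have htail : P {ω | 15 * t + 6 * D ≤ sgdPotential f θstar R β (fun k => θ k ω) N}
      ≤ ENNReal.ofReal (2 * Real.exp (-t)) := by
    rw [← ofReal_measureReal]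
    refine ENNReal.ofReal_le_ofReal ?_
    refine (ProbabilityTheory.measure_ge_le_exp_mul_mgf _ (by norm_num) hint).trans ?_
    refine (mul_le_mul_of_nonneg_left hle (Real.exp_pos _).le).trans ?_
    have h2 : (2 : ℝ) = Real.exp (Real.log 2) := (Real.exp_log two_pos).symm
    rw [h2, ← Real.exp_add, ← Real.exp_add]
    refine Real.exp_le_exp.2 ?_
    have := Real.log_two_gt_d9
    linarith
  refine ⟨(measure_mono fun ω hω => ?_).trans htail, (measure_mono fun ω hω => ?_).trans htail⟩
  · have hjensen : f ((N : ℝ)⁻¹ • ∑ k ∈ Finset.range N, θ k ω)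
        ≤ ∑ k ∈ Finset.range N, (N : ℝ)⁻¹ * f (θ k ω) := by
      rw [Finset.smul_sum]
      refine hf_conv.map_sum_le (fun _ _ => by positivity) ?_ (fun _ _ => Set.mem_univ _)
      simp [hN0.ne']
    rw [← Finset.mul_sum] at hjensen
    have hsum := sum_le_sgdPotential (f := f) (x₀ := θstar) (R := R) (β := β)
      (x := fun k => θ k ω) N
    rw [Finset.sum_sub_distrib, Finset.sum_const, Finset.card_range, nsmul_eq_mul] at hsum
    have hω' : 15 * t / √(N : ℝ) + 6 * R ^ 2 * ‖θ0 - θstar‖ ^ 2 / √(N : ℝ)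
        ≤ (N : ℝ)⁻¹ * ∑ k ∈ Finset.range N, f (θ k ω) - f θstar :=
      le_trans hω (by linarith)
    refine le_trans ?_ hsum
    rw [← add_div, div_le_iff₀ hs] at hω'
    refine le_trans (by linarith) (hω'.trans_eq ?_)
    have hβ' : 2 * β = √(N : ℝ) * (N : ℝ)⁻¹ := by
      rw [← div_eq_mul_inv, eq_div_iff hN0.ne']
      linear_combination √(N : ℝ) * hβs - 2 * β * hs2
    rw [hβ']
    field_simp
  · refine le_trans ?_ (sq_dist_le_sgdPotential (x := fun k => θ k ω) hβ0.le hmin N)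
    have h := mul_le_mul_of_nonneg_left hω.le (sq_nonneg R)
    refine le_trans (le_of_eq ?_) h
    rw [hD]
    field_simp
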